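/- arXiv:1202.4798 — 2 statements merged into one kernel-verified Lean document; each statement's English description precedes it below -/
import Mathlib

section
/- Let x = P(x) be a maxPPS in SNF with least fixed point q* satisfying 0 < q* < 1, and let y ∈ ℝ^n with 0 ≤ y ≤ q*. Then the linearized system x = P^y(x) has a least fixed point μP^y, which satisfies μP^y ≤ q*; μP^y is the unique optimal solution of the program 'minimize Σ_i a_i subject to P^y(a) ≤ a'; and for every optimal policy τ of x = P(x), the Newton iterate N_τ(y) is defined and μP^y ≥ N_τ(y). -/
open Matrix Finset

namespace PPS

/-- One equation of a max/min PPS in simple normal form (SNF):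
form L (linear), form Q (product of two variables), or form M
(max or min of two variables, according to the kind of the system). -/
inductive Eqn (n : ℕ) where
  | lin (a0 : ℝ) (a : Fin n → ℝ) : Eqn n
  | quad (j k : Fin n) : Eqn n
  | m (j k : Fin n) : Eqn n

namespace Eqn

/-- Validity of the coefficients of a form-L equation: all coefficients,
including the constant term, are nonnegative and sum to at most 1. -/
def Valid {n : ℕ} : Eqn n → Prop
  | .lin a0 a => 0 ≤ a0 ∧ (∀ j, 0 ≤ a j) ∧ a0 + ∑ j, a j ≤ 1
  | _ => True

/-- Evaluate one equation; `isMax` says whether form-M equations are max or min. -/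
def eval {n : ℕ} (isMax : Bool) : Eqn n → (Fin n → ℝ) → ℝ
  | .lin a0 a, x => a0 + ∑ j, a j * x j
  | .quad j k, x => x j * x k
  | .m j k, x => if isMax then max (x j) (x k) else min (x j) (x k)

/-- An equation of form L or Q (no max/min). -/
def IsLinOrQuad {n : ℕ} : Eqn n → Prop
  | .m _ _ => False
  | _ => True

/-- Row of the Jacobian matrix of one (form L or Q) equation at the point `y`. -/
def jacRow {n : ℕ} : Eqn n → (Fin n → ℝ) → (Fin n → ℝ)
  | .lin _ a, _ => a
  | .quad j k, y => fun l => (if l = j then y k else 0) + (if l = k then y j else 0)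
  | .m _ _, _ => fun _ => 0

end Eqn

/-- A system of `n` equations in `n` variables, in SNF. -/
abbrev Sys (n : ℕ) : Type := Fin n → Eqn n

/-- All equations have valid (probabilistic) coefficients. -/
def SysValid {n : ℕ} (S : Sys n) : Prop := ∀ i, (S i).Valid

/-- A PPS: a system with no form-M equations. -/
def IsPPS {n : ℕ} (S : Sys n) : Prop := ∀ i, (S i).IsLinOrQuad

/-- The map `P : ℝ^n → ℝ^n` of the system. -/
def eval {n : ℕ} (isMax : Bool) (S : Sys n) (x : Fin n → ℝ) : Fin n → ℝ :=
  fun i => (S i).eval isMax x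

/-- The Jacobian matrix `P'(y)`. -/
def jac {n : ℕ} (S : Sys n) (y : Fin n → ℝ) : Matrix (Fin n) (Fin n) ℝ :=
  Matrix.of fun i l => (S i).jacRow y l

/-- `q` is the least fixed point of `x = P(x)` in `[0,1]^n`. -/
def IsLFP {n : ℕ} (isMax : Bool) (S : Sys n) (q : Fin n → ℝ) : Prop :=
  eval isMax S q = q ∧ (∀ i, 0 ≤ q i) ∧ (∀ i, q i ≤ 1) ∧
    (∀ q' : Fin n → ℝ, eval isMax S q' = q' → (∀ i, 0 ≤ q' i) → (∀ i, q' i ≤ 1) →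
      ∀ i, q i ≤ q' i)

/-- Applying a policy `σ` (a choice, for each form-M equation `max/min {x_j, x_k}`,
of one of the two variables: `true` picks `x_j`, `false` picks `x_k`) to the system,
yielding the PPS `x = P_σ(x)`. -/
def applyPolicy {n : ℕ} (S : Sys n) (σ : Fin n → Bool) : Sys n := fun i =>
  match S i with
  | .m j k => .lin 0 (fun l => if l = (if σ i then j else k) then 1 else 0)
  | e => e

/-- The linearization `P^y` of `P` at `y`: equations of form L and M are unchanged,
and a form-Q equation `x_j x_k` becomes `y_j x_k + x_j y_k - y_j y_k`. -/
def linEval {n : ℕ} (isMax : Bool) (S : Sys n) (y x : Fin n → ℝ) : Fin n → ℝ := fun i =>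
  match S i with
  | .quad j k => y j * x k + x j * y k - y j * y k
  | e => e.eval isMax x

/-- The Newton operator `N(y) = y + (I - P'(y))⁻¹ (P(y) - y)`. -/
noncomputable def newton {n : ℕ} (isMax : Bool) (S : Sys n) (y : Fin n → ℝ) : Fin n → ℝ :=
  y + (1 - jac S y)⁻¹ *ᵥ (eval isMax S y - y)

/-- the l∞ norm of a vector -/
noncomputable def vnorm {n : ℕ} (v : Fin n → ℝ) : ℝ := ⨆ i, |v i|

/-- the l∞ (max absolute row sum) norm of a matrix -/
noncomputable def mnorm {n : ℕ} (A : Matrix (Fin n) (Fin n) ℝ) : ℝ := ⨆ i, ∑ j, |A i j|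

end PPS
/-- `τ` is an optimal policy of the maxPPS `x = P(x)`, with `qτ` the LFP of `x = P_τ(x)`:
`q*_τ ≥ q*_σ` for every policy `σ`. -/
def PPS.OptMaxPolicy {n : ℕ} (S : PPS.Sys n) (τ : Fin n → Bool) (qτ : Fin n → ℝ) : Prop :=
  PPS.IsLFP true (PPS.applyPolicy S τ) qτ ∧
  ∀ (σ : Fin n → Bool) (qσ : Fin n → ℝ),
    PPS.IsLFP true (PPS.applyPolicy S σ) qσ → ∀ i, qσ i ≤ qτ i

namespace PPS

variable {n : ℕ}

/-- Knaster–Tarski for maps that are monotone above a lower bound `l`. -/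
theorem exists_least_prefixed (F : (Fin n → ℝ) → (Fin n → ℝ)) (l : Fin n → ℝ)
    (hmono : ∀ x z, l ≤ x → x ≤ z → F x ≤ F z) (hl : ∀ x, l ≤ x → F x ≤ x → l ≤ F x)
    (hne : ∃ x, l ≤ x ∧ F x ≤ x) :
    ∃ m, l ≤ m ∧ F m = m ∧ ∀ x, l ≤ x → F x ≤ x → m ≤ x := by
  obtain ⟨x₀, hx₀⟩ := hne
  let A : Set (Fin n → ℝ) := {x | l ≤ x ∧ F x ≤ x}
  let m : Fin n → ℝ := fun i => sInf ((fun x => x i) '' A)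
  have hne' : ∀ i, ((fun x : Fin n → ℝ => x i) '' A).Nonempty := fun i => ⟨_, x₀, hx₀, rfl⟩
  have hm : ∀ x, l ≤ x → F x ≤ x → m ≤ x := fun x h1 h2 i =>
    csInf_le ⟨l i, by rintro _ ⟨z, hz, rfl⟩; exact hz.1 i⟩ ⟨x, ⟨h1, h2⟩, rfl⟩
  have hlm : l ≤ m := fun i => le_csInf (hne' i) (by rintro _ ⟨z, hz, rfl⟩; exact hz.1 i)
  have hFm : F m ≤ m := fun i => le_csInf (hne' i) (by
    rintro _ ⟨z, hz, rfl⟩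
    exact (hmono m z hlm (hm z hz.1 hz.2) i).trans (hz.2 i))
  have hlF := hl m hlm hFm
  exact ⟨m, hlm, le_antisymm hFm (hm _ hlF (hmono _ _ hlF hFm)), hm⟩

theorem eval_mono {S : Sys n} (hS : SysValid S) {x z : Fin n → ℝ} (hx : 0 ≤ x) (hxz : x ≤ z) :
    eval true S x ≤ eval true S z := by
  intro i
  have hv := hS i
  simp only [eval]
  cases h : S i with
  | lin a0 a =>
    rw [h] at hv
    simp only [Eqn.eval]
    gcongr with j
    · exact hv.2.1 j
    · exact hxz j
  | quad j k => exact mul_le_mul (hxz j) (hxz k) (hx k) ((hx j).trans (hxz j))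
  | m j k => simpa [Eqn.eval] using max_le_max (hxz j) (hxz k)

theorem eval_nonneg {S : Sys n} (hS : SysValid S) {x : Fin n → ℝ} (hx : 0 ≤ x) :
    0 ≤ eval true S x := by
  intro i
  have hv := hS i
  simp only [eval]
  cases h : S i with
  | lin a0 a =>
    rw [h] at hv
    exact add_nonneg hv.1 (sum_nonneg fun j _ => mul_nonneg (hv.2.1 j) (hx j))
  | quad j k => exact mul_nonneg (hx j) (hx k)
  | m j k => simpa [Eqn.eval] using Or.inl (hx j)

theorem eval_one_le {S : Sys n} (hS : SysValid S) : eval true S 1 ≤ 1 := by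
  intro i
  have hv := hS i
  simp only [eval]
  cases h : S i with
  | lin a0 a =>
    rw [h] at hv
    simpa [Eqn.eval] using hv.2.2
  | quad j k => simp [Eqn.eval]
  | m j k => simp [Eqn.eval]

theorem exists_isLFP {S : Sys n} (hS : SysValid S) {x : Fin n → ℝ} (hx0 : 0 ≤ x) (hx1 : x ≤ 1)
    (hx : eval true S x ≤ x) : ∃ p, IsLFP true S p ∧ p ≤ x := by
  obtain ⟨m, h0, hm, hle⟩ := exists_least_prefixed (eval true S) 0
    (fun x z => eval_mono hS) (fun x h _ => eval_nonneg hS h) ⟨x, hx0, hx⟩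
  exact ⟨m, ⟨hm, h0, (hle x hx0 hx).trans hx1, fun p hp hp0 _ => hle p hp0 hp.le⟩, hle x hx0 hx⟩

theorem IsLFP.le_of_eval_le {S : Sys n} (hS : SysValid S) {p x : Fin n → ℝ}
    (hp : IsLFP true S p) (hx0 : 0 ≤ x) (hx1 : x ≤ 1) (hx : eval true S x ≤ x) : p ≤ x := by
  obtain ⟨m, hm, hmx⟩ := exists_isLFP hS hx0 hx1 hx
  exact le_trans (hp.2.2.2 m hm.1 hm.2.1 hm.2.2.1) hmx

theorem SysValid.applyPolicy {S : Sys n} (hS : SysValid S) (σ : Fin n → Bool) :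
    SysValid (applyPolicy S σ) := by
  intro i
  have hv := hS i
  unfold PPS.applyPolicy
  cases h : S i with
  | lin a0 a => simpa [h] using hv
  | quad j k => trivial
  | m j k =>
    refine ⟨le_rfl, fun l => ?_, ?_⟩
    · dsimp only; split_ifs <;> norm_num
    · simp

theorem isPPS_applyPolicy (S : Sys n) (σ : Fin n → Bool) : IsPPS (applyPolicy S σ) := by
  intro i
  unfold applyPolicy
  cases h : S i <;> trivial

theorem eval_applyPolicy_le (S : Sys n) (σ : Fin n → Bool) (x : Fin n → ℝ) :
    eval true (applyPolicy S σ) x ≤ eval true S x := by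
  intro i
  unfold applyPolicy eval
  cases h : S i with
  | lin a0 a => simp [h]
  | quad j k => simp [h]
  | m j k => cases hσ : σ i <;> simp [h, hσ, Eqn.eval]

theorem linEval_applyPolicy_le (S : Sys n) (σ : Fin n → Bool) (y x : Fin n → ℝ) :
    linEval true (applyPolicy S σ) y x ≤ linEval true S y x := by
  intro i
  unfold applyPolicy linEval
  cases h : S i with
  | lin a0 a => simp [h]
  | quad j k => simp [h]
  | m j k => cases hσ : σ i <;> simp [h, hσ, Eqn.eval]

theorem linEval_mono {S : Sys n} (hS : SysValid S) {y x z : Fin n → ℝ} (hy : 0 ≤ y)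
    (hxz : x ≤ z) : linEval true S y x ≤ linEval true S y z := by
  intro i
  have hv := hS i
  simp only [linEval]
  cases h : S i with
  | lin a0 a =>
    rw [h] at hv
    simp only [Eqn.eval]
    gcongr with j
    · exact hv.2.1 j
    · exact hxz j
  | quad j k =>
    have h1 := mul_le_mul_of_nonneg_left (hxz k) (hy j)
    have h2 := mul_le_mul_of_nonneg_right (hxz j) (hy k)
    dsimp only
    linarith
  | m j k => simpa [Eqn.eval] using max_le_max (hxz j) (hxz k)

theorem linEval_le_eval (S : Sys n) {y x : Fin n → ℝ} (hyx : y ≤ x) :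
    linEval true S y x ≤ eval true S x := by
  intro i
  simp only [linEval, eval]
  cases h : S i with
  | lin a0 a => exact le_rfl
  | quad j k =>
    have := mul_nonneg (sub_nonneg.2 (hyx j)) (sub_nonneg.2 (hyx k))
    simp only [Eqn.eval]
    linarith
  | m j k => exact le_rfl

theorem linEval_eq_eval_add_jac {T : Sys n} (hT : IsPPS T) (y x : Fin n → ℝ) :
    linEval true T y x = eval true T y + jac T y *ᵥ (x - y) := by
  ext i
  have hp := hT i
  simp only [linEval, eval, jac, Pi.add_apply, Matrix.mulVec, dotProduct, Matrix.of_apply]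
  cases h : T i with
  | lin a0 a =>
    simp only [Eqn.eval, Eqn.jacRow, Pi.sub_apply, mul_sub, sum_sub_distrib]
    ring
  | quad j k =>
    simp only [Eqn.eval, Eqn.jacRow, Pi.sub_apply, add_mul, ite_mul, zero_mul, sum_add_distrib,
      sum_ite_eq', mem_univ, if_true]
    ring
  | m j k => rw [h] at hp; exact hp.elim

/-- A PPS is convex on the segment from a point of `[0,1]^n` to the all-ones vector. -/
theorem eval_segment_le {T : Sys n} (hT : IsPPS T) (hv : SysValid T) {x : Fin n → ℝ}
    (hx1 : x ≤ 1) {t : ℝ} (ht0 : 0 ≤ t) (ht1 : t ≤ 1) (i : Fin n) :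
    eval true T (fun j => x j + t * (1 - x j)) i ≤
      eval true T x i + t * (1 - eval true T x i) := by
  have hp := hT i
  have hv := hv i
  simp only [eval]
  cases h : T i with
  | lin a0 a =>
    rw [h] at hv
    simp only [Eqn.eval]
    have e : ∑ j, a j * (x j + t * (1 - x j)) =
        (∑ j, a j * x j) + t * (∑ j, a j - ∑ j, a j * x j) := by
      rw [← sum_sub_distrib, mul_sum, ← sum_add_distrib]
      exact sum_congr rfl fun j _ => by ring
    have := mul_nonneg ht0 (sub_nonneg.2 hv.2.2)
    rw [e]
    linarith
  | quad j k =>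
    have hj : 0 ≤ 1 - x j := sub_nonneg.2 (hx1 j)
    have hk : 0 ≤ 1 - x k := sub_nonneg.2 (hx1 k)
    have := mul_nonneg (mul_nonneg ht0 (sub_nonneg.2 ht1)) (mul_nonneg hj hk)
    simp only [Eqn.eval]
    linarith
  | m j k => rw [h] at hp; exact hp.elim

/-- Replacing equations of a PPS only where this strictly increases the value at the least fixed
point does not decrease the least fixed point. -/
theorem IsLFP.le_of_improvement {T T' : Sys n} (hT : SysValid T) (hT' : SysValid T')
    (hP' : IsPPS T') {p p' : Fin n → ℝ} (hp : IsLFP true T p) (hp' : IsLFP true T' p')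
    (hlt : ∀ i, p' i < 1) (himp : ∀ i, T' i = T i ∨ p i < eval true T' p i) : p ≤ p' := by
  have hp'1 : p' ≤ 1 := hp'.2.2.1
  have hp0 : 0 ≤ p := hp.2.1
  have key : ∀ t : ℝ, 0 ≤ t → t ≤ 1 →
      (∀ i, T' i ≠ T i → p i ≤ p' i + t * (1 - p' i)) →
      (∀ i, p i ≤ p' i + t * (1 - p' i)) ∧
        ∀ i, T' i ≠ T i → p i < p' i + t * (1 - p' i) := by
    intro t ht0 ht1 ht
    let g : Fin n → ℝ := fun j => p' j + t * (1 - p' j)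
    have hg0 : 0 ≤ g := fun j =>
      add_nonneg (hp'.2.1 j) (mul_nonneg ht0 (sub_nonneg.2 (hp'1 j)))
    have hg : ∀ i, eval true T' g i ≤ g i := fun i => by
      have := eval_segment_le hP' hT' hp'1 ht0 ht1 i
      rwa [hp'.1] at this
    have hinf0 : 0 ≤ g ⊓ p := le_inf hg0 hp0
    have hpg : p ≤ g ⊓ p := by
      refine hp.le_of_eval_le hT hinf0 (inf_le_right.trans hp.2.2.1) (le_inf ?_ ?_)
      · intro i
        by_cases h : T' i = T i
        · have := (eval_mono hT' hinf0 (inf_le_left : g ⊓ p ≤ g) i).trans (hg i)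
          simpa only [eval, h] using this
        · refine (eval_mono hT hinf0 (inf_le_right : g ⊓ p ≤ p) i).trans ?_
          rw [hp.1]
          exact ht i h
      · exact (eval_mono hT hinf0 inf_le_right).trans hp.1.le
    have hpg' : p ≤ g := hpg.trans inf_le_left
    exact ⟨hpg', fun i hi => ((himp i).resolve_left hi).trans_le
      ((eval_mono hT' hp0 hpg' i).trans (hg i))⟩
  classical
  by_cases hall : ∀ i, T' i ≠ T i → p i ≤ p' i
  · intro i
    simpa using (key 0 le_rfl zero_le_one (by simpa using hall)).1 i
  · push Not at hall
    obtain ⟨i₀, hi₀, hlt₀⟩ := hall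
    let r : Fin n → ℝ := fun i => (p i - p' i) / (1 - p' i)
    have hpos : ∀ i, 0 < 1 - p' i := fun i => sub_pos.2 (hlt i)
    obtain ⟨i, hi, hmax⟩ := exists_max_image (univ.filter fun i => T' i ≠ T i) r
      ⟨i₀, by simpa using hi₀⟩
    have hr0 : 0 ≤ r i := le_trans (div_nonneg (sub_nonneg.2 hlt₀.le) (hpos i₀).le)
      (hmax i₀ (by simpa using hi₀))
    have hr1 : r i ≤ 1 := by
      rw [div_le_one (hpos i)]
      have := hp.2.2.1 i
      linarith
    have := (key (r i) hr0 hr1 (fun j hj => by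
      have h := hmax j (by simpa using hj)
      rw [div_le_iff₀ (hpos j)] at h
      linarith)).2 i (by simpa using hi)
    have e : r i * (1 - p' i) = p i - p' i := div_mul_cancel₀ _ (hpos i).ne'
    linarith

theorem exists_policy_improvement (S : Sys n) (σ : Fin n → Bool) (x : Fin n → ℝ) :
    ∃ σ' : Fin n → Bool, eval true (applyPolicy S σ') x = eval true S x ∧
      ∀ i, applyPolicy S σ' i = applyPolicy S σ i ∨
        eval true (applyPolicy S σ) x i < eval true (applyPolicy S σ') x i := by
  have h : ∀ i, ∃ b : Bool, ∀ σ' : Fin n → Bool, σ' i = b →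
      eval true (applyPolicy S σ') x i = eval true S x i ∧
      (applyPolicy S σ' i = applyPolicy S σ i ∨
        eval true (applyPolicy S σ) x i < eval true (applyPolicy S σ') x i) := by
    intro i
    simp only [eval, applyPolicy]
    cases h : S i with
    | lin a0 a => simp
    | quad j k => simp
    | m j k =>
      rcases lt_trichotomy (x j) (x k) with hlt | heq | hlt
      · refine ⟨false, fun σ' h' => ?_⟩
        cases hσ : σ i <;> simp [h', Eqn.eval, hlt, hlt.le]
      · refine ⟨σ i, fun σ' h' => ?_⟩
        cases hσ : σ i <;> simp [h', Eqn.eval, hσ, heq]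
      · refine ⟨true, fun σ' h' => ?_⟩
        cases hσ : σ i <;> simp [h', Eqn.eval, hlt, hlt.le]
  choose b hb using h
  exact ⟨b, funext fun i => (hb i b rfl).1, fun i => (hb i b rfl).2⟩

/-- A policy whose value cannot be improved attains the least fixed point of the maxPPS. -/
theorem IsLFP.eq_of_maximal {S : Sys n} (hS : SysValid S) {q : Fin n → ℝ} (hq : IsLFP true S q)
    (h1 : ∀ i, q i < 1) {σ : Fin n → Bool} {p : Fin n → ℝ}
    (hp : IsLFP true (applyPolicy S σ) p)
    (hmax : ∀ σ' p', IsLFP true (applyPolicy S σ') p' → p ≤ p' → p' ≤ p) : p = q := by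
  have hle : ∀ σ' p', IsLFP true (applyPolicy S σ') p' → p' ≤ q := fun σ' p' hp' =>
    hp'.le_of_eval_le (hS.applyPolicy σ') hq.2.1 hq.2.2.1
      ((eval_applyPolicy_le S σ' q).trans hq.1.le)
  obtain ⟨σ', hσ', himp⟩ := exists_policy_improvement S σ p
  obtain ⟨p', hp', -⟩ := exists_isLFP (hS.applyPolicy σ') zero_le_one le_rfl
    (eval_one_le (hS.applyPolicy σ'))
  rw [hp.1] at himp
  have hpp' : p ≤ p' := hp.le_of_improvement (hS.applyPolicy σ) (hS.applyPolicy σ')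
    (isPPS_applyPolicy S σ') hp' (fun i => (hle σ' p' hp' i).trans_lt (h1 i)) himp
  obtain rfl : p = p' := le_antisymm hpp' (hmax σ' p' hp' hpp')
  exact le_antisymm (hle σ p hp)
    (hq.2.2.2 p (hσ'.symm.trans hp'.1) hp.2.1 hp.2.2.1)

theorem exists_policy_isLFP {S : Sys n} (hS : SysValid S) {q : Fin n → ℝ} (hq : IsLFP true S q)
    (h1 : ∀ i, q i < 1) : ∃ σ, IsLFP true (applyPolicy S σ) q := by
  have hex : ∀ σ, ∃ p, IsLFP true (applyPolicy S σ) p := fun σ =>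
    (exists_isLFP (hS.applyPolicy σ) zero_le_one le_rfl (eval_one_le (hS.applyPolicy σ))).imp
      fun _ h => h.1
  choose p hp using hex
  obtain ⟨σ, hσ⟩ := Finite.exists_max fun σ => ∑ i, p σ i
  refine ⟨σ, ?_⟩
  rw [← hq.eq_of_maximal hS h1 (hp σ) ?_]
  · exact hp σ
  · intro σ' p' hp' hle
    have e : p' = p σ' := le_antisymm (hp'.2.2.2 _ (hp σ').1 (hp σ').2.1 (hp σ').2.2.1)
      ((hp σ').2.2.2 _ hp'.1 hp'.2.1 hp'.2.2.1)
    subst e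
    have := (sum_eq_sum_iff_of_le fun i _ => hle i).1
      (le_antisymm (sum_le_sum fun i _ => hle i) (hσ σ'))
    exact fun i => (this i (mem_univ i)).ge

theorem jac_nonneg {T : Sys n} (hv : SysValid T) {y : Fin n → ℝ} (hy : 0 ≤ y) (i j : Fin n) :
    0 ≤ jac T y i j := by
  have hv := hv i
  simp only [jac, Matrix.of_apply]
  cases h : T i with
  | lin a0 a => rw [h] at hv; exact hv.2.1 j
  | quad a b =>
    have := hy a
    have := hy b
    simp only [Eqn.jacRow]
    split_ifs <;> simp_all
  | m a b => exact le_rfl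

/-- Below a least fixed point lying strictly between `0` and `1`, the Jacobian `B` of a PPS
satisfies `B v ≤ v → 0 ≤ v`. -/
theorem IsLFP.nonneg_of_jac_mulVec_le {T : Sys n} (hT : IsPPS T) (hv : SysValid T)
    {q : Fin n → ℝ} (hq : IsLFP true T q) (h0 : ∀ i, 0 < q i) (h1 : ∀ i, q i < 1)
    {y : Fin n → ℝ} (hy0 : 0 ≤ y) (hyq : y ≤ q) {v : Fin n → ℝ} (hBv : jac T y *ᵥ v ≤ v) :
    0 ≤ v := by
  by_contra hneg
  obtain ⟨i₀, hi₀⟩ : ∃ i, v i < 0 := by simpa [Pi.le_def] using hneg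
  let w : Fin n → ℝ := 1 - q
  have hw : ∀ i, 0 < w i := fun i => sub_pos.2 (h1 i)
  have hqi : ∀ i, (T i).eval true q = q i := fun i => congrFun hq.1 i
  have hquad : ∀ i j k, T i = .quad j k → (jac T y *ᵥ w) i < w i := by
    intro i j k h
    have hqi := hqi i
    rw [h] at hqi
    simp only [Eqn.eval] at hqi
    have hj := hw j
    have hk := hw k
    have := mul_le_mul_of_nonneg_right (hyq j) hk.le
    have := mul_le_mul_of_nonneg_right (hyq k) hj.le
    have := mul_pos hj hk
    simp only [jac, Matrix.mulVec, dotProduct, Matrix.of_apply, h, Eqn.jacRow, add_mul, ite_mul,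
      zero_mul, sum_add_distrib, sum_ite_eq', mem_univ, if_true]
    simp only [w, Pi.sub_apply, Pi.one_apply] at *
    linarith
  have hBw : ∀ i, (jac T y *ᵥ w) i ≤ w i := by
    intro i
    have hp := hT i
    have hvi := hv i
    have hqi := hqi i
    cases h : T i with
    | lin a0 a =>
      rw [h] at hvi hqi
      have := hvi.2.2
      simp only [Eqn.eval] at hqi
      simp only [jac, Matrix.mulVec, dotProduct, Matrix.of_apply, h, Eqn.jacRow, w, Pi.sub_apply,
        Pi.one_apply, mul_sub, mul_one, sum_sub_distrib]
      linarith
    | quad j k => exact (hquad i j k h).le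
    | m j k => rw [h] at hp; exact hp.elim
  obtain ⟨i₁, -, hmax⟩ := exists_max_image univ (fun i => -v i / w i) ⟨i₀, mem_univ _⟩
  set t := -v i₁ / w i₁
  have htpos : 0 < t :=
    (div_pos (neg_pos.2 hi₀) (hw i₀)).trans_le (hmax i₀ (mem_univ _))
  let u : Fin n → ℝ := v + t • w
  have hu0 : ∀ i, 0 ≤ u i := fun i => by
    have h := hmax i (mem_univ _)
    rw [div_le_iff₀ (hw i)] at h
    simp only [u, Pi.add_apply, Pi.smul_apply, smul_eq_mul]
    linarith
  have hu1 : u i₁ = 0 := by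
    have : t * w i₁ = -v i₁ := div_mul_cancel₀ _ (hw i₁).ne'
    simp only [u, Pi.add_apply, Pi.smul_apply, smul_eq_mul]
    linarith
  have hBu : ∀ i, (jac T y *ᵥ u) i = (jac T y *ᵥ v) i + t * (jac T y *ᵥ w) i := fun i => by
    simp [u, Matrix.mulVec_add, Matrix.mulVec_smul]
  have hBu0 : ∀ i, 0 ≤ (jac T y *ᵥ u) i := fun i =>
    sum_nonneg (s := univ) (f := fun j => jac T y i j * u j)
      fun j _ => mul_nonneg (jac_nonneg hv hy0 i j) (hu0 j)
  have hui : ∀ i, u i = v i + t * w i := fun i => rfl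
  have hZw : ∀ i, u i = 0 → w i ≤ (jac T y *ᵥ w) i := by
    intro i hi
    have h2 := hBu0 i
    have h3 := hBv i
    rw [hBu] at h2
    rw [hui] at hi
    have : 0 ≤ t * ((jac T y *ᵥ w) i - w i) := by linarith
    exact sub_nonneg.1 (nonneg_of_mul_nonneg_right this htpos)
  have hZ : ∀ i, u i = 0 → ∀ j, u j ≠ 0 → jac T y i j = 0 := by
    intro i hi j hj
    have h2 : (jac T y *ᵥ u) i = 0 := by
      refine le_antisymm ?_ (hBu0 i)
      have h3 := hBv i
      have h4 := mul_le_mul_of_nonneg_left (hBw i) htpos.le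
      rw [hBu]
      rw [hui] at hi
      linarith
    have h3 := (sum_eq_zero_iff_of_nonneg (s := univ) (f := fun j => jac T y i j * u j)
      fun j _ => mul_nonneg (jac_nonneg hv hy0 i j) (hu0 j)).1 h2 j (mem_univ j)
    exact (mul_eq_zero.1 h3).resolve_right hj
  obtain ⟨i₂, -, hmin⟩ := exists_min_image univ q ⟨i₀, mem_univ _⟩
  set d := q i₂
  have hdpos : 0 < d := h0 i₂
  let q' : Fin n → ℝ := fun i => if u i = 0 then q i - d * w i else q i
  have hq'q : q' ≤ q := fun i => by
    have := mul_pos hdpos (hw i)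
    simp only [q']
    split_ifs <;> linarith
  have hq'0 : 0 ≤ q' := fun i => by
    have h2 := hmin i (mem_univ i)
    have h3 : d * w i ≤ d * 1 :=
      mul_le_mul_of_nonneg_left (by simp only [w, Pi.sub_apply, Pi.one_apply]; linarith [h0 i])
        hdpos.le
    have h4 := h0 i
    simp only [q', Pi.zero_apply]
    split_ifs <;> linarith
  have hq' : eval true T q' ≤ q' := by
    intro i
    by_cases hi : u i = 0
    · have hw' := hZw i hi
      have hz := hZ i hi
      have hp := hT i
      have hqi := hqi i
      have e : q' i = q i - d * w i := if_pos hi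
      rw [e]
      cases h : T i with
      | lin a0 a =>
        simp only [jac, Matrix.mulVec, dotProduct, Matrix.of_apply, h, Eqn.jacRow] at hw' hz
        rw [h] at hqi
        simp only [Eqn.eval] at hqi
        have e2 : ∑ j, a j * q' j = ∑ j, a j * q j - d * ∑ j, a j * w j := by
          rw [mul_sum, ← sum_sub_distrib]
          refine sum_congr rfl fun j _ => ?_
          by_cases hj : u j = 0
          · simp only [q', if_pos hj]; ring
          · simp [hz j hj]
        have := mul_le_mul_of_nonneg_left hw' hdpos.le
        simp only [eval, h, Eqn.eval]
        linarith
      | quad j k => exact absurd hw' (not_le.2 (hquad i j k h))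
      | m j k => rw [h] at hp; exact hp.elim
    · have e : q' i = q i := if_neg hi
      rw [e]
      exact (eval_mono hv hq'0 hq'q i).trans (congrFun hq.1 i).le
  have hfin := hq.le_of_eval_le hv hq'0 (hq'q.trans hq.2.2.1) hq' i₁
  have e : q' i₁ = q i₁ - d * w i₁ := if_pos hu1
  have := mul_pos hdpos (hw i₁)
  linarith

theorem IsLFP.isUnit_one_sub_jac {T : Sys n} (hT : IsPPS T) (hv : SysValid T)
    {q : Fin n → ℝ} (hq : IsLFP true T q) (h0 : ∀ i, 0 < q i) (h1 : ∀ i, q i < 1)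
    {y : Fin n → ℝ} (hy0 : 0 ≤ y) (hyq : y ≤ q) : IsUnit (1 - jac T y) := by
  rw [← Matrix.mulVec_injective_iff_isUnit]
  intro a b hab
  have hz : jac T y *ᵥ (a - b) = a - b := by
    have : (1 - jac T y) *ᵥ (a - b) = 0 := by
      rw [Matrix.mulVec_sub]
      exact sub_eq_zero.2 hab
    rw [Matrix.sub_mulVec, Matrix.one_mulVec] at this
    exact (sub_eq_zero.1 this).symm
  have h2 := hq.nonneg_of_jac_mulVec_le hT hv h0 h1 hy0 hyq hz.le
  have h3 := hq.nonneg_of_jac_mulVec_le hT hv h0 h1 hy0 hyq (v := -(a - b))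
    (by rw [Matrix.mulVec_neg, hz])
  exact sub_eq_zero.1 (le_antisymm (neg_nonneg.1 h3) h2)

theorem IsLFP.newton_le {T : Sys n} (hT : IsPPS T) (hv : SysValid T)
    {q : Fin n → ℝ} (hq : IsLFP true T q) (h0 : ∀ i, 0 < q i) (h1 : ∀ i, q i < 1)
    {y : Fin n → ℝ} (hy0 : 0 ≤ y) (hyq : y ≤ q) {a : Fin n → ℝ}
    (ha : linEval true T y a ≤ a) : newton true T y ≤ a := by
  have hu := (Matrix.isUnit_iff_isUnit_det _).1 (hq.isUnit_one_sub_jac hT hv h0 h1 hy0 hyq)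
  rw [linEval_eq_eval_add_jac hT] at ha
  have e : (1 - jac T y) *ᵥ (newton true T y - y) = eval true T y - y := by
    rw [newton, add_sub_cancel_left, Matrix.mulVec_mulVec, Matrix.mul_nonsing_inv _ hu,
      Matrix.one_mulVec]
  rw [Matrix.sub_mulVec, Matrix.one_mulVec] at e
  refine sub_nonneg.1 (hq.nonneg_of_jac_mulVec_le hT hv h0 h1 hy0 hyq ?_)
  intro i
  have e1 : a - newton true T y = (a - y) - (newton true T y - y) := by abel
  have e2 := congrFun e i
  have e3 := ha i
  rw [e1, Matrix.mulVec_sub]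
  simp only [Pi.sub_apply, Pi.add_apply] at *
  linarith

end PPS

open PPS in
/-- Let `x = P(x)` be a maxPPS in SNF with LFP `0 < q* < 1` and `0 ≤ y ≤ q*`.  Then the
linearized system `x = P^y(x)` has a least fixed point `μP^y ≤ q*`; it is the unique
optimal solution of the program "minimize `∑ᵢ aᵢ` subject to `P^y(a) ≤ a`"; and for
every optimal policy `τ`, `N_τ(y)` is defined and `μP^y ≥ N_τ(y)`. -/
theorem stmt4 {n : ℕ} (S : Sys n) (hval : SysValid S)
    (q : Fin n → ℝ) (hq : IsLFP true S q) (h0 : ∀ i, 0 < q i) (h1 : ∀ i, q i < 1)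
    (y : Fin n → ℝ) (hy0 : ∀ i, 0 ≤ y i) (hyq : ∀ i, y i ≤ q i) :
    ∃ μ : Fin n → ℝ,
      linEval true S y μ = μ ∧
      (∀ z : Fin n → ℝ, linEval true S y z = z → ∀ i, μ i ≤ z i) ∧
      (∀ i, μ i ≤ q i) ∧
      (∀ a : Fin n → ℝ, (∀ i, linEval true S y a i ≤ a i) →
        (∑ i, μ i ≤ ∑ i, a i) ∧ (∑ i, a i = ∑ i, μ i → a = μ)) ∧
      (∀ (τ : Fin n → Bool) (qτ : Fin n → ℝ), PPS.OptMaxPolicy S τ qτ →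
        IsUnit (1 - jac (applyPolicy S τ) y) ∧
        ∀ i, newton true (applyPolicy S τ) y i ≤ μ i) := by
  obtain ⟨σ, hσ⟩ := exists_policy_isLFP hval hq h1
  have hnewton : ∀ τ, IsLFP true (applyPolicy S τ) q → ∀ a, linEval true S y a ≤ a →
      newton true (applyPolicy S τ) y ≤ a := fun τ hτ a ha =>
    hτ.newton_le (isPPS_applyPolicy S τ) (hval.applyPolicy τ) h0 h1 hy0 hyq
      ((linEval_applyPolicy_le S τ y a).trans ha)
  have hqpre : linEval true S y q ≤ q := (linEval_le_eval S hyq).trans hq.1.le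
  obtain ⟨μ, -, hfix, hleast⟩ := exists_least_prefixed (linEval true S y)
    (newton true (applyPolicy S σ) y) (fun x z _ => linEval_mono hval hy0)
    (fun x _ hx => hnewton σ hσ _ (linEval_mono hval hy0 hx)) ⟨q, hnewton σ hσ q hqpre, hqpre⟩
  have hle : ∀ a, linEval true S y a ≤ a → μ ≤ a := fun a ha => hleast a (hnewton σ hσ a ha) ha
  refine ⟨μ, hfix, fun z hz => hle z hz.le, hle q hqpre, fun a ha => ⟨?_, fun hsum => ?_⟩, ?_⟩
  · exact sum_le_sum fun i _ => hle a ha i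
  · have := (sum_eq_sum_iff_of_le fun i _ => hle a ha i).1 hsum.symm
    exact funext fun i => (this i (mem_univ i)).symm
  · rintro τ qτ ⟨hτ, hopt⟩
    obtain rfl : qτ = q := hq.eq_of_maximal hval h1 hτ fun σ' p' hp' _ => hopt σ' p' hp'
    exact ⟨hτ.isUnit_one_sub_jac (isPPS_applyPolicy S τ) (hval.applyPolicy τ) h0 h1 hy0 hyq,
      hnewton τ hτ μ hfix.le⟩
end

section
/- Let x = P(x) be a minPPS in SNF with least fixed point q* satisfying 0 < q* < 1, and let y ∈ ℝ^n with 0 ≤ y ≤ q*. Then there exists a policy σ such that P^y(N_σ(y)) = N_σ(y), i.e., the Newton iterate N_σ(y) is a fixed point of the linearized min system. -/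
open Matrix Finset

namespace PPS

/-- A map that is monotone on `[u, v]`, with `u ≤ f u` and `f v ≤ v`, has a fixed point
in `[u, v]`. -/
theorem exists_fixedPoint_mem_Icc {α : Type*} [ConditionallyCompleteLattice α] {f : α → α}
    {u v : α} (huv : u ≤ v) (hf : MonotoneOn f (Set.Icc u v)) (hu : u ≤ f u) (hv : f v ≤ v) :
    ∃ x ∈ Set.Icc u v, f x = x := by
  set s : Set α := {x | x ∈ Set.Icc u v ∧ f x ≤ x} with hs
  have hvs : v ∈ s := ⟨⟨huv, le_rfl⟩, hv⟩
  have hbdd : BddBelow s := ⟨u, fun x hx => hx.1.1⟩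
  have huz : u ≤ sInf s := le_csInf ⟨v, hvs⟩ fun x hx => hx.1.1
  have hzv : sInf s ≤ v := csInf_le hbdd hvs
  have hfz : f (sInf s) ≤ sInf s := le_csInf ⟨v, hvs⟩ fun x hx =>
    (hf ⟨huz, hzv⟩ hx.1 (csInf_le hbdd hx)).trans hx.2
  have hufz : u ≤ f (sInf s) := hu.trans (hf ⟨le_rfl, huv⟩ ⟨huz, hzv⟩ huz)
  exact ⟨sInf s, ⟨huz, hzv⟩, le_antisymm hfz
    (csInf_le hbdd ⟨⟨hufz, hfz.trans hzv⟩, hf ⟨hufz, hfz.trans hzv⟩ ⟨huz, hzv⟩ hfz⟩)⟩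

variable {n : ℕ} {S : Sys n} {q y : Fin n → ℝ}

theorem eval_mono_of_nonneg (hval : SysValid S) {x z : Fin n → ℝ} (hx : 0 ≤ x) (hxz : x ≤ z) :
    eval false S x ≤ eval false S z := by
  intro i
  have hv := hval i
  unfold eval
  cases hi : S i with
  | lin a0 a =>
    rw [hi] at hv
    simp only [Eqn.eval]
    gcongr with l
    · exact hv.2.1 l
    · exact hxz l
  | quad j k =>
    exact mul_le_mul (hxz j) (hxz k) (hx k) ((hx j).trans (hxz j))
  | m j k =>
    simpa [Eqn.eval] using min_le_min (hxz j) (hxz k)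

theorem linEval_mono_s8 (hval : SysValid S) (hy0 : ∀ i, 0 ≤ y i) : Monotone (linEval false S y) := by
  intro x z hxz i
  have hv := hval i
  unfold linEval
  cases hi : S i with
  | lin a0 a =>
    rw [hi] at hv
    simp only [Eqn.eval]
    gcongr with l
    · exact hv.2.1 l
    · exact hxz l
  | quad j k =>
    have h1 := mul_le_mul_of_nonneg_left (hxz k) (hy0 j)
    have h2 := mul_le_mul_of_nonneg_right (hxz j) (hy0 k)
    simp only
    linarith
  | m j k =>
    simpa [Eqn.eval] using min_le_min (hxz j) (hxz k)

/-- The least fixed point lies below every nonnegative pre-fixed point. -/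
theorem IsLFP.le_of_eval_le_s8 (hval : SysValid S) (hq : IsLFP false S q) {v : Fin n → ℝ}
    (hv0 : 0 ≤ v) (hv1 : ∀ i, v i ≤ 1) (hv : eval false S v ≤ v) : q ≤ v := by
  have hz : (0 : Fin n → ℝ) ≤ eval false S 0 := by
    intro i
    have hi' := hval i
    unfold eval
    cases hi : S i with
    | lin a0 a =>
      rw [hi] at hi'
      simpa [Eqn.eval] using hi'.1
    | quad j k => simp [Eqn.eval]
    | m j k => simp [Eqn.eval]
  obtain ⟨x, hx, hfx⟩ := exists_fixedPoint_mem_Icc hv0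
    (fun x hx z _ hxz => eval_mono_of_nonneg hval hx.1 hxz) hz hv
  exact fun i => (hq.2.2.2 x hfx (fun i => hx.1 i) (fun i => (hx.2 i).trans (hv1 i)) i).trans
    (hx.2 i)

/-- Replacing a positive least fixed point by `0` on a nonempty set of coordinates makes
some equation of this set positive. -/
theorem IsLFP.exists_eval_ite_pos (hval : SysValid S) (hq : IsLFP false S q)
    (h0 : ∀ i, 0 < q i) {D : Fin n → Prop} [DecidablePred D] (hD : ∃ i, D i) :
    ∃ i, D i ∧ 0 < eval false S (fun l => if D l then 0 else q l) i := by
  by_contra! hcon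
  obtain ⟨i, hi⟩ := hD
  have hle : (fun l => if D l then 0 else q l) ≤ q := by
    intro l
    dsimp only
    split_ifs
    exacts [(h0 l).le, le_rfl]
  have hnn : (0 : Fin n → ℝ) ≤ fun l => if D l then 0 else q l := by
    intro l
    dsimp only
    split_ifs
    exacts [le_rfl, (h0 l).le]
  have hqi := hq.le_of_eval_le_s8 hval hnn (fun l => (hle l).trans (hq.2.2.1 l)) (fun l => by
    by_cases hl : D l
    · simpa [hl] using hcon l hl
    · have h := eval_mono_of_nonneg hval hnn hle l
      rw [hq.1] at h
      simpa [hl] using h) i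
  simp only [hi, if_true] at hqi
  exact absurd (h0 i) (not_lt.mpr hqi)

theorem jac_applyPolicy_mulVec (σ : Fin n → Bool) (w : Fin n → ℝ) (i : Fin n) :
    (jac (applyPolicy S σ) y *ᵥ w) i = match S i with
      | .lin _ a => ∑ l, a l * w l
      | .quad j k => y k * w j + y j * w k
      | .m j k => w (if σ i then j else k) := by
  simp only [mulVec, dotProduct, jac, applyPolicy, of_apply]
  cases hi : S i with
  | lin a0 a => rfl
  | quad j k => simp [Eqn.jacRow, add_mul, Finset.sum_add_distrib]
  | m j k => simp [Eqn.jacRow]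

/-- Comparison principle for the Jacobian of a policy at a point below the least fixed point. -/
theorem nonpos_of_le_jac_applyPolicy_mulVec (hval : SysValid S) (hq : IsLFP false S q)
    (h0 : ∀ i, 0 < q i) (h1 : ∀ i, q i < 1) (hy0 : ∀ i, 0 ≤ y i) (hyq : ∀ i, y i ≤ q i)
    (σ : Fin n → Bool) {w : Fin n → ℝ} (hw : w ≤ jac (applyPolicy S σ) y *ᵥ w) : w ≤ 0 := by
  classical
  intro i₀
  by_contra! hi₀
  have hd : ∀ i, 0 < 1 - q i := fun i => sub_pos.mpr (h1 i)
  obtain ⟨i₁, -, hmax⟩ := Finset.exists_max_image Finset.univ (fun i => w i / (1 - q i))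
    ⟨i₀, Finset.mem_univ _⟩
  set c := w i₁ / (1 - q i₁) with hc
  have hc0 : 0 < c := (div_pos hi₀ (hd i₀)).trans_le (hmax i₀ (Finset.mem_univ _))
  have hwc : ∀ l, w l ≤ c * (1 - q l) := fun l =>
    (div_le_iff₀ (hd l)).mp (hmax l (Finset.mem_univ _))
  have hwi₁ : w i₁ = c * (1 - q i₁) := by
    rw [hc, div_mul_cancel₀ _ (hd i₁).ne']
  obtain ⟨i₂, hi₂, hmin⟩ := Finset.exists_min_image
    (Finset.univ.filter fun l => w l = c * (1 - q l)) q ⟨i₁, by simpa using hwi₁⟩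
  have hi₂ : w i₂ = c * (1 - q i₂) := by simpa using hi₂
  have hmin : ∀ l, w l = c * (1 - q l) → q i₂ ≤ q l := fun l hl => hmin l (by simpa using hl)
  obtain ⟨i, ⟨hwi, hqi⟩, hpos⟩ := hq.exists_eval_ite_pos hval h0
    (D := fun l => w l = c * (1 - q l) ∧ q l = q i₂) ⟨i₂, hi₂, rfl⟩
  have hwi' := hw i
  have hfix := congrFun hq.1 i
  have hv := hval i
  rw [jac_applyPolicy_mulVec, hwi] at hwi'
  refine absurd hpos (not_lt.mpr ?_)
  unfold eval at hfix ⊢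
  cases hi : S i with
  | lin a0 a =>
    simp only [hi, Eqn.eval, Eqn.Valid] at hwi' hfix hv ⊢
    obtain ⟨ha0, ha, hsum⟩ := hv
    have hmul : ∑ l, a l * (c * (1 - q l)) = c * (∑ l, a l - ∑ l, a l * q l) := by
      rw [← Finset.sum_sub_distrib, Finset.mul_sum]
      exact Finset.sum_congr rfl fun l _ => by ring
    have hle : ∑ l, a l * w l ≤ ∑ l, a l * (c * (1 - q l)) :=
      Finset.sum_le_sum fun l _ => mul_le_mul_of_nonneg_left (hwc l) (ha l)
    have hone : 1 ≤ a0 + ∑ l, a l := by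
      have := le_of_mul_le_mul_left (hwi'.trans (hle.trans hmul.le)) hc0
      linarith
    have hone : a0 + ∑ l, a l = 1 := le_antisymm hsum hone
    have heq : ∑ l, a l * w l = ∑ l, a l * (c * (1 - q l)) := by
      refine le_antisymm hle ?_
      rw [hmul]
      refine le_trans (le_of_eq ?_) hwi'
      rw [← hfix, ← hone]
      ring
    have htight := (Finset.sum_eq_sum_iff_of_le
      fun l _ => mul_le_mul_of_nonneg_left (hwc l) (ha l)).mp heq
    have hC : ∀ l, a l = 0 ∨ w l = c * (1 - q l) := fun l => by
      rcases eq_or_ne (a l) 0 with h | h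
      · exact Or.inl h
      · exact Or.inr (mul_left_cancel₀ h (htight l (Finset.mem_univ _)))
    have hnn : ∀ l ∈ Finset.univ, 0 ≤ a l * (q l - q i) := fun l _ => by
      rcases hC l with h | h
      · simp [h]
      · exact mul_nonneg (ha l) (sub_nonneg.mpr (hqi ▸ hmin l h))
    have hzero : a0 * (1 - q i) + ∑ l, a l * (q l - q i) = 0 := by
      simp only [mul_sub, Finset.sum_sub_distrib, ← Finset.sum_mul]
      linear_combination hfix - q i * hone
    have hs0 := Finset.sum_nonneg hnn
    have ha0' := mul_nonneg ha0 (hd i).le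
    have ha0z : a0 = 0 := by
      have : a0 * (1 - q i) = 0 := by linarith
      exact (mul_eq_zero.mp this).resolve_right (hd i).ne'
    have hterm := (Finset.sum_eq_zero_iff_of_nonneg hnn).mp (by linarith)
    rw [ha0z, zero_add]
    refine (Finset.sum_eq_zero fun l hl => ?_).le
    rcases eq_or_ne (a l) 0 with h | h
    · simp [h]
    · have hql := (mul_eq_zero.mp (hterm l hl)).resolve_left h
      rw [if_pos ⟨(hC l).resolve_left h, by linarith⟩, mul_zero]
  | quad j k =>
    exfalso
    simp only [hi, Eqn.eval] at hwi' hfix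
    have hj := mul_le_mul_of_nonneg_left (hwc j) (hy0 k)
    have hk := mul_le_mul_of_nonneg_left (hwc k) (hy0 j)
    have hj' := mul_le_mul_of_nonneg_right (hyq k) (mul_pos hc0 (hd j)).le
    have hk' := mul_le_mul_of_nonneg_right (hyq j) (mul_pos hc0 (hd k)).le
    have hgap := mul_pos hc0 (mul_pos (hd j) (hd k))
    rw [← hfix] at hwi'
    linarith
  | m j k =>
    simp only [hi, Eqn.eval, Bool.false_eq_true, if_false] at hwi' hfix ⊢
    set s := if σ i then j else k with hs
    have hsj : s = j ∨ s = k := by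
      rw [hs]; split_ifs <;> simp
    have hqs : q i ≤ q s := by
      rw [← hfix]
      rcases hsj with h | h <;> simp [h]
    have hcs : c * (1 - q s) ≤ c * (1 - q i) := by gcongr
    have hws : w s = c * (1 - q s) := le_antisymm (hwc s) (hcs.trans hwi')
    have hqs' : q s = q i := by
      have := le_of_mul_le_mul_left (hwi'.trans hws.le) hc0
      linarith
    have hz : (if w s = c * (1 - q s) ∧ q s = q i₂ then 0 else q s) = 0 :=
      if_pos ⟨hws, hqs'.trans hqi⟩
    rcases hsj with h | h <;> rw [h] at hz
    · exact (min_le_left _ _).trans hz.le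
    · exact (min_le_right _ _).trans hz.le

theorem isUnit_one_sub_jac_applyPolicy (hval : SysValid S) (hq : IsLFP false S q)
    (h0 : ∀ i, 0 < q i) (h1 : ∀ i, q i < 1) (hy0 : ∀ i, 0 ≤ y i) (hyq : ∀ i, y i ≤ q i)
    (σ : Fin n → Bool) : IsUnit (1 - jac (applyPolicy S σ) y) := by
  rw [Matrix.isUnit_iff_isUnit_det, isUnit_iff_ne_zero]
  intro hdet
  obtain ⟨w, hw0, hw⟩ := Matrix.exists_mulVec_eq_zero_iff.mpr hdet
  rw [sub_mulVec, one_mulVec, sub_eq_zero] at hw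
  have hle := nonpos_of_le_jac_applyPolicy_mulVec hval hq h0 h1 hy0 hyq σ hw.le
  have hge := nonpos_of_le_jac_applyPolicy_mulVec hval hq h0 h1 hy0 hyq σ (w := -w)
    (by rw [mulVec_neg, ← hw])
  exact hw0 (le_antisymm hle (neg_nonpos.mp hge))

/-- The linearized min system at a point below the least fixed point has a fixed point. -/
theorem exists_linEval_fixedPoint (hval : SysValid S) (hq : IsLFP false S q)
    (h1 : ∀ i, q i < 1) (hy0 : ∀ i, 0 ≤ y i) (hyq : ∀ i, y i ≤ q i) :
    ∃ x, linEval false S y x = x := by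
  have hd : ∀ i, 0 < 1 - q i := fun i => sub_pos.mpr (h1 i)
  obtain ⟨t, ht0, ht⟩ : ∃ t : ℝ, 0 ≤ t ∧ ∀ j k, 1 ≤ t * ((1 - q j) * (1 - q k)) := by
    refine ⟨∑ j, ∑ k, ((1 - q j) * (1 - q k))⁻¹, ?_, fun j k => ?_⟩
    · exact Finset.sum_nonneg fun j _ => Finset.sum_nonneg fun k _ =>
        (inv_pos.mpr (mul_pos (hd j) (hd k))).le
    · rw [← div_le_iff₀ (mul_pos (hd j) (hd k)), one_div]
      refine le_trans ?_ (Finset.single_le_sum (f := fun j => ∑ k, ((1 - q j) * (1 - q k))⁻¹)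
        (fun j _ => Finset.sum_nonneg fun k _ => (inv_pos.mpr (mul_pos (hd j) (hd k))).le)
        (Finset.mem_univ j))
      exact Finset.single_le_sum (f := fun k => ((1 - q j) * (1 - q k))⁻¹)
        (fun k _ => (inv_pos.mpr (mul_pos (hd j) (hd k))).le) (Finset.mem_univ k)
  have huq : (fun i => q i - t * (1 - q i)) ≤ q := fun i => by
    have := mul_nonneg ht0 (hd i).le
    dsimp only
    linarith
  have hlower : (fun i => q i - t * (1 - q i)) ≤
      linEval false S y fun i => q i - t * (1 - q i) := by
    intro i
    have hfix := congrFun hq.1 i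
    have hv := hval i
    unfold eval at hfix
    unfold linEval
    cases hi : S i with
    | lin a0 a =>
      simp only [hi, Eqn.eval, Eqn.Valid] at hfix hv ⊢
      have hs : ∑ l, a l * (q l - t * (1 - q l)) =
          (1 + t) * ∑ l, a l * q l - t * ∑ l, a l := by
        rw [Finset.mul_sum, Finset.mul_sum, ← Finset.sum_sub_distrib]
        exact Finset.sum_congr rfl fun l _ => by ring
      have := mul_nonneg ht0 (sub_nonneg.mpr hv.2.2)
      rw [hs, ← hfix]
      linarith
    | quad j k =>
      simp only [hi, Eqn.eval] at hfix ⊢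
      have hprod : (q j - y j) * (q k - y k) ≤ 1 := by
        refine mul_le_one₀ ?_ (sub_nonneg.mpr (hyq k)) ?_
        · linarith [hy0 j, h1 j]
        · linarith [hy0 k, h1 k]
      have hj := mul_le_mul_of_nonneg_left
        (mul_le_mul_of_nonneg_right (hyq k) (hd j).le) ht0
      have hk := mul_le_mul_of_nonneg_left
        (mul_le_mul_of_nonneg_right (hyq j) (hd k).le) ht0
      rw [← hfix]
      linarith [ht j k]
    | m j k =>
      simp only [hi, Eqn.eval, Bool.false_eq_true, if_false] at hfix ⊢
      have hmono : ∀ l, q i ≤ q l → q i - t * (1 - q i) ≤ q l - t * (1 - q l) := by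
        intro l hl
        gcongr
      exact le_min (hmono j (hfix ▸ min_le_left _ _)) (hmono k (hfix ▸ min_le_right _ _))
  have hupper : linEval false S y q ≤ q := by
    intro i
    have hfix := congrFun hq.1 i
    unfold eval at hfix
    unfold linEval
    cases hi : S i with
    | lin a0 a => simpa [hi] using hfix.le
    | quad j k =>
      simp only [hi, Eqn.eval] at hfix ⊢
      have := mul_nonneg (sub_nonneg.mpr (hyq j)) (sub_nonneg.mpr (hyq k))
      linarith
    | m j k => simpa [hi] using hfix.le
  obtain ⟨x, -, hx⟩ := exists_fixedPoint_mem_Icc huq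
    ((linEval_mono_s8 hval hy0).monotoneOn _) hlower hupper
  exact ⟨x, hx⟩

/-- At every point `x` some policy attains the minimum, so that the linearized min system
agrees at `x` with the first-order expansion of the policy's system. -/
theorem exists_policy_linEval_eq (S : Sys n) (y x : Fin n → ℝ) : ∃ σ : Fin n → Bool,
    linEval false S y x =
      eval false (applyPolicy S σ) y + jac (applyPolicy S σ) y *ᵥ (x - y) := by
  refine ⟨fun i => match S i with
    | .m j k => decide (x j ≤ x k)
    | _ => true, funext fun i => ?_⟩
  rw [Pi.add_apply, jac_applyPolicy_mulVec]
  unfold linEval eval applyPolicy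
  cases hi : S i with
  | lin a0 a => simp [Eqn.eval, mul_sub]
  | quad j k =>
    simp only [Eqn.eval, Pi.sub_apply]
    ring
  | m j k =>
    rcases le_or_gt (x j) (x k) with h | h
    · simp [Eqn.eval, hi, h]
    · simp [Eqn.eval, hi, h.le, not_le.mpr h]

end PPS

open PPS in
/-- Let `x = P(x)` be a minPPS in SNF with LFP `0 < q* < 1` and `0 ≤ y ≤ q*`.  Then
there is a policy `σ` such that `P^y(N_σ(y)) = N_σ(y)`, i.e. the Newton iterate
`N_σ(y)` (which is defined) is a fixed point of the linearized min system. -/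
theorem stmt8 {n : ℕ} (S : Sys n) (hval : SysValid S)
    (q : Fin n → ℝ) (hq : IsLFP false S q) (h0 : ∀ i, 0 < q i) (h1 : ∀ i, q i < 1)
    (y : Fin n → ℝ) (hy0 : ∀ i, 0 ≤ y i) (hyq : ∀ i, y i ≤ q i) :
    ∃ σ : Fin n → Bool,
      IsUnit (1 - jac (applyPolicy S σ) y) ∧
      linEval false S y (newton false (applyPolicy S σ) y)
        = newton false (applyPolicy S σ) y := by
  obtain ⟨x, hx⟩ := exists_linEval_fixedPoint hval hq h1 hy0 hyq
  obtain ⟨σ, hσ⟩ := exists_policy_linEval_eq S y x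
  have hunit := isUnit_one_sub_jac_applyPolicy hval hq h0 h1 hy0 hyq σ
  have hnewton : newton false (applyPolicy S σ) y = x := by
    have hres : eval false (applyPolicy S σ) y - y =
        (1 - jac (applyPolicy S σ) y) *ᵥ (x - y) := by
      rw [sub_mulVec, one_mulVec, eq_sub_of_add_eq (hσ.symm.trans hx)]
      abel
    rw [newton, hres, mulVec_mulVec,
      Matrix.nonsing_inv_mul _ ((Matrix.isUnit_iff_isUnit_det _).mp hunit), one_mulVec,
      add_sub_cancel]
  exact ⟨σ, hunit, by rw [hnewton, hx]⟩
end
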